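/- For every real number p with 2 < p < 3 and every real number β with β ≥ p²·(1 + Σ_{l=1}^∞ (2/l)^{3/p}), one has Σ_{j=1}^∞ 1/(β·Γ(j/p + 1)) < 1. -/

import Mathlib

theorem Real.half_le_Gamma {x : ℝ} (hx : 1 ≤ x) : 1 / 2 ≤ Real.Gamma x := by
  rcases le_total 2 x with h | h
  · have := Real.Gamma_strictMonoOn_Ici.monotoneOn (Set.mem_Ici.2 le_rfl) (Set.mem_Ici.2 h) h
    rw [Real.Gamma_two] at this
    linarith
  · have := Real.Gamma_strictMonoOn_Ici.monotoneOn (Set.mem_Ici.2 le_rfl)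
      (Set.mem_Ici.2 (show (2 : ℝ) ≤ x + 1 by linarith)) (by linarith)
    rw [Real.Gamma_two, Real.Gamma_add_one (by linarith)] at this
    nlinarith

theorem Real.two_pow_div_two_le_Gamma {x : ℝ} (m : ℕ) (hx : (m : ℝ) + 1 ≤ x) :
    (2 : ℝ) ^ m / 2 ≤ Real.Gamma x := by
  rcases m with _ | m
  · simpa using Real.half_le_Gamma (by simpa using hx)
  · have h2 : (2 : ℝ) ≤ ((m + 1 : ℕ) : ℝ) + 1 := by
      push_cast
      linarith [m.cast_nonneg (α := ℝ)]
    have hmono := Real.Gamma_strictMonoOn_Ici.monotoneOn (Set.mem_Ici.2 h2)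
      (Set.mem_Ici.2 (h2.trans hx)) hx
    rw [Real.Gamma_nat_eq_factorial] at hmono
    have hfac : (2 : ℝ) ^ m ≤ ((m + 1).factorial : ℝ) := by
      have h := Nat.factorial_mul_pow_le_factorial (m := 1) (n := m)
      rw [Nat.factorial_one, one_mul, add_comm 1 m] at h
      exact_mod_cast h
    rw [pow_succ]
    linarith

theorem inv_Gamma_le_geometric {p : ℝ} (hp0 : 0 < p) (hp3 : p < 3) (j : ℕ) :
    1 / Real.Gamma (((j : ℝ) + 1) / p + 1) ≤ 5 / 2 * (4 / 5) ^ j := by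
  have hfloor : ((((j + 1) / 3 : ℕ) : ℝ)) + 1 ≤ ((j : ℝ) + 1) / p + 1 := by
    have h : (((j + 1) / 3 : ℕ) : ℝ) ≤ ((j : ℝ) + 1) / 3 := by
      simpa using Nat.cast_div_le (α := ℝ) (m := j + 1) (n := 3)
    have h' : ((j : ℝ) + 1) / 3 ≤ ((j : ℝ) + 1) / p := by gcongr
    linarith
  have hGamma := Real.two_pow_div_two_le_Gamma _ hfloor
  have hpow : (5 / 4 : ℝ) ^ j ≤ 2 ^ ((j + 1) / 3) * (5 / 4) := calc
    (5 / 4 : ℝ) ^ j ≤ (5 / 4) ^ (3 * ((j + 1) / 3) + 1) :=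
      pow_le_pow_right₀ (by norm_num) (by omega)
    _ = ((5 / 4) ^ 3) ^ ((j + 1) / 3) * (5 / 4) := by rw [pow_succ, pow_mul]
    _ ≤ 2 ^ ((j + 1) / 3) * (5 / 4) := by
      gcongr
      norm_num
  have hprod : (4 / 5 : ℝ) ^ j * (5 / 4) ^ j = 1 := by
    rw [← mul_pow]
    norm_num
  have hpos : (0 : ℝ) < (4 / 5) ^ j := by positivity
  have hGpos : 0 < Real.Gamma (((j : ℝ) + 1) / p + 1) := Real.Gamma_pos_of_pos (by positivity)
  rw [div_le_iff₀ hGpos]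
  nlinarith

theorem three_le_tsum_two_div_rpow {s : ℝ} (hs : 1 < s) :
    3 ≤ ∑' l : ℕ, (2 / ((l : ℝ) + 1)) ^ s := by
  have hsum : Summable fun l : ℕ => (2 / ((l : ℝ) + 1)) ^ s := by
    have h := ((summable_nat_add_iff 1).2 (Real.summable_one_div_nat_rpow.2 hs)).mul_left (2 ^ s)
    refine h.congr fun l => ?_
    rw [Real.div_rpow (by norm_num) (by positivity)]
    push_cast
    ring
  have h := hsum.sum_le_tsum (Finset.range 2) fun l _ => by positivity
  have h2 : (2 : ℝ) ≤ 2 ^ s := Real.self_le_rpow_of_one_le (by norm_num) hs.le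
  norm_num [Finset.sum_range_succ] at h
  linarith

/-- For `2 < p < 3` and any `β ≥ p²(1 + Σ_{l=1}^∞ (2/l)^{3/p})`, the quantity
`α_p = Σ_{j=1}^∞ 1/(β·(j/p)!)` is strictly less than `1`, where `x! = Γ(x+1)`.
(The sums over `l ≥ 1` and `j ≥ 1` are written as sums over `l, j : ℕ` shifted
by one.) -/
theorem alpha_p_lt_one (p β : ℝ) (hp2 : 2 < p) (hp3 : p < 3)
    (hβ : β ≥ p ^ 2 * (1 + ∑' l : ℕ, (2 / ((l : ℝ) + 1)) ^ ((3 : ℝ) / p))) :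
    ∑' j : ℕ, 1 / (β * Real.Gamma (((j : ℝ) + 1) / p + 1)) < 1 := by
  have hp0 : 0 < p := by linarith
  have hβ16 : 16 ≤ β := by
    have h := three_le_tsum_two_div_rpow ((one_lt_div hp0).2 hp3)
    nlinarith
  have hterm (j : ℕ) : 1 / (β * Real.Gamma (((j : ℝ) + 1) / p + 1)) ≤
      1 / 16 * (5 / 2 * (4 / 5) ^ j) := by
    have hGpos : 0 < Real.Gamma (((j : ℝ) + 1) / p + 1) := Real.Gamma_pos_of_pos (by positivity)
    rw [← one_div_mul_one_div]
    gcongr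
    exact inv_Gamma_le_geometric hp0 hp3 j
  have hgeom : HasSum (fun j : ℕ => 1 / 16 * (5 / 2 * (4 / 5 : ℝ) ^ j))
      (1 / 16 * (5 / 2 * (1 - 4 / 5)⁻¹)) :=
    ((hasSum_geometric_of_lt_one (by norm_num) (by norm_num)).mul_left _).mul_left _
  have hsum : Summable fun j : ℕ => 1 / (β * Real.Gamma (((j : ℝ) + 1) / p + 1)) :=
    hgeom.summable.of_nonneg_of_le (fun j => by
      have hGpos : 0 < Real.Gamma (((j : ℝ) + 1) / p + 1) := Real.Gamma_pos_of_pos (by positivity)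
      positivity) hterm
  calc _ ≤ _ := hsum.tsum_le_of_sum_le fun s =>
        (Finset.sum_le_sum fun j _ => hterm j).trans
          (sum_le_hasSum s (fun j _ => by positivity) hgeom)
    _ < 1 := by norm_num
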